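/- Let L and M be even lattices lying in the same genus, i.e., for every prime p the quadratic modules L⊗ℤ_p and M⊗ℤ_p over the p-adic integers ℤ_p are isometric, and L⊗ℝ and M⊗ℝ are isometric. Then the discriminant forms (L*/L, q_L) and (M*/M, q_M) are isometric as finite quadratic spaces, and L and M have equal signatures. -/

import Mathlib

open scoped BigOperators

noncomputable section

/-- The group `ℚ/ℤ`. -/
abbrev QmodZ : Type := ℚ ⧸ AddSubgroup.zmultiples (1 : ℚ)

/-- The group `ℚ/2ℤ`. -/
abbrev Qmod2Z : Type := ℚ ⧸ AddSubgroup.zmultiples (2 : ℚ)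

/-- The isomorphism `ℚ/2ℤ → ℚ/ℤ` induced by dividing by `2`. -/
noncomputable def halfHom : Qmod2Z →+ QmodZ :=
  QuotientAddGroup.map _ _ (AddMonoidHom.mk' (fun x : ℚ => x / 2) (fun a b => add_div a b 2))
    (by
      intro x hx
      obtain ⟨k, rfl⟩ := AddSubgroup.mem_zmultiples_iff.mp hx
      refine AddSubgroup.mem_zmultiples_iff.mpr ⟨k, ?_⟩
      show k • (1:ℚ) = (k • (2:ℚ)) / 2
      push_cast [zsmul_eq_mul]
      ring)

/-- The bilinear form `b(x,y) = (q(x+y) - q(x) - q(y))/2 ∈ ℚ/ℤ` associated to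
`q : A → ℚ/2ℤ`. -/
def bForm {A : Type*} [AddCommGroup A] (q : A → Qmod2Z) (x y : A) : QmodZ :=
  halfHom (q (x + y) - q x - q y)

/-- `q : A → ℚ/2ℤ` is a finite quadratic space structure on the finite abelian group `A`
if the associated form `b` is `ℤ`-bilinear (i.e. biadditive) and nondegenerate. -/
structure IsFiniteQuadraticSpace {A : Type*} [AddCommGroup A] [Finite A]
    (q : A → Qmod2Z) : Prop where
  add_left : ∀ x x' y, bForm q (x + x') y = bForm q x y + bForm q x' y
  add_right : ∀ x y y', bForm q x (y + y') = bForm q x y + bForm q x y'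
  nondeg : ∀ x, (∀ y, bForm q x y = 0) → x = 0

/-- Two quadratic forms are isometric if some group isomorphism carries one to the other. -/
def FQSIsometric {A B : Type*} [AddCommGroup A] [AddCommGroup B]
    (qA : A → Qmod2Z) (qB : B → Qmod2Z) : Prop :=
  ∃ e : A ≃+ B, ∀ x, qB (e x) = qA x

/-- An even lattice, given by its rank and Gram matrix: the Gram matrix is symmetric,
has even diagonal (so `(x,x)` is always even) and is nondegenerate. -/
structure EvenLattice : Type where
  n : ℕ
  B : Matrix (Fin n) (Fin n) ℤ
  symm : B.IsSymm
  even_diag : ∀ i, 2 ∣ B i i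
  nondeg : B.det ≠ 0

/-- The bilinear form of `L` extended to `R^n` for any commutative ring `R ⊇ ℤ`. -/
def formR (L : EvenLattice) (R : Type*) [CommRing R] (x y : Fin L.n → R) : R :=
  ∑ i, ∑ j, (L.B i j : R) * x i * y j

theorem formR_zero_left (L : EvenLattice) (R : Type*) [CommRing R] (y : Fin L.n → R) :
    formR L R 0 y = 0 := by
  simp [formR]

theorem formR_add_left (L : EvenLattice) (R : Type*) [CommRing R] (x x' y : Fin L.n → R) :
    formR L R (x + x') y = formR L R x y + formR L R x' y := by
  simp [formR, mul_add, add_mul, Finset.sum_add_distrib]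

theorem formR_neg_left (L : EvenLattice) (R : Type*) [CommRing R] (x y : Fin L.n → R) :
    formR L R (-x) y = -formR L R x y := by
  simp [formR, Finset.sum_neg_distrib]

/-- `L` and `M` are isometric over `R`. -/
def IsometricOver (R : Type*) [CommRing R] (L M : EvenLattice) : Prop :=
  ∃ e : (Fin L.n → R) ≃ₗ[R] (Fin M.n → R), ∀ x y, formR M R (e x) (e y) = formR L R x y

/-- `L` and `M` lie in the same genus: they are isometric over `ℤ_p` for all primes `p`
and over `ℝ`. -/
def SameGenus (L M : EvenLattice) : Prop :=
  (∀ (p : ℕ) [Fact p.Prime], IsometricOver ℤ_[p] L M) ∧ IsometricOver ℝ L M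

/-- The subgroup of integral vectors in `ℚ^n`, i.e. the lattice `L` itself inside `L ⊗ ℚ`. -/
def intSub (L : EvenLattice) : AddSubgroup (Fin L.n → ℚ) where
  carrier := {x | ∀ i, ∃ m : ℤ, x i = m}
  zero_mem' := fun i => ⟨0, by simp⟩
  add_mem' := by
    intro x y hx hy i
    obtain ⟨mx, hmx⟩ := hx i
    obtain ⟨my, hmy⟩ := hy i
    exact ⟨mx + my, by simp [hmx, hmy]⟩
  neg_mem' := by
    intro x hx i
    obtain ⟨m, hm⟩ := hx i
    exact ⟨-m, by simp [hm]⟩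

/-- The dual lattice of a subgroup `K` of `L ⊗ ℚ`:
all vectors pairing integrally with every element of `K`. -/
def dualOf (L : EvenLattice) (K : AddSubgroup (Fin L.n → ℚ)) : AddSubgroup (Fin L.n → ℚ) where
  carrier := {x | ∀ y ∈ K, ∃ m : ℤ, formR L ℚ x y = m}
  zero_mem' := fun y _ => ⟨0, by simp [formR_zero_left]⟩
  add_mem' := by
    intro x x' hx hx' y hy
    obtain ⟨m, hm⟩ := hx y hy
    obtain ⟨m', hm'⟩ := hx' y hy
    exact ⟨m + m', by rw [formR_add_left, hm, hm']; push_cast; ring⟩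
  neg_mem' := by
    intro x hx y hy
    obtain ⟨m, hm⟩ := hx y hy
    exact ⟨-m, by rw [formR_neg_left, hm]; push_cast; ring⟩

/-- The dual lattice `L^*` of `L`. -/
abbrev dualSub (L : EvenLattice) : AddSubgroup (Fin L.n → ℚ) := dualOf L (intSub L)

/-- The discriminant group `K^*/K` of a subgroup `K` of `L ⊗ ℚ`. -/
abbrev discGroupOf (L : EvenLattice) (K : AddSubgroup (Fin L.n → ℚ)) : Type :=
  dualOf L K ⧸ K.addSubgroupOf (dualOf L K)

/-- The discriminant group `L^*/L`. -/
abbrev discGroup (L : EvenLattice) : Type := discGroupOf L (intSub L)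

/-- The discriminant form on `K^*/K`, `q(x + K) = (x,x) mod 2ℤ`
(defined via a choice of representative; it is independent of this choice). -/
noncomputable def discQOf (L : EvenLattice) (K : AddSubgroup (Fin L.n → ℚ)) :
    discGroupOf L K → Qmod2Z :=
  fun a => (QuotientAddGroup.mk (formR L ℚ (a.out : Fin L.n → ℚ) (a.out : Fin L.n → ℚ)) : Qmod2Z)

/-- The discriminant form `q_L` on `L^*/L`. -/
noncomputable def discQ (L : EvenLattice) : discGroup L → Qmod2Z := discQOf L (intSub L)

/-- `n₊`: the maximal dimension of a positive definite subspace of `L ⊗ ℝ`. -/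
noncomputable def sigPlus (L : EvenLattice) : ℕ :=
  sSup {d : ℕ | ∃ W : Submodule ℝ (Fin L.n → ℝ), Module.finrank ℝ W = d ∧
    ∀ x ∈ W, x ≠ 0 → 0 < formR L ℝ x x}

/-- `n₋`: the maximal dimension of a negative definite subspace of `L ⊗ ℝ`. -/
noncomputable def sigMinus (L : EvenLattice) : ℕ :=
  sSup {d : ℕ | ∃ W : Submodule ℝ (Fin L.n → ℝ), Module.finrank ℝ W = d ∧
    ∀ x ∈ W, x ≠ 0 → formR L ℝ x x < 0}

end

open Matrix

def LocIso (L M : EvenLattice) (R : Type*) [CommRing R] : Prop :=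
  ∃ (U : Matrix (Fin M.n) (Fin L.n) R) (V : Matrix (Fin L.n) (Fin M.n) R),
    Uᵀ * M.B.map (Int.cast : ℤ → R) * U = L.B.map (Int.cast : ℤ → R) ∧ U * V = 1 ∧ V * U = 1

theorem formR_eq (L : EvenLattice) (R : Type*) [CommRing R] (x y : Fin L.n → R) :
    formR L R x y = x ⬝ᵥ (L.B.map (Int.cast : ℤ → R) *ᵥ y) := by
  simp only [formR, dotProduct, mulVec, Finset.mul_sum, Matrix.map_apply]
  refine Finset.sum_congr rfl fun i _ => Finset.sum_congr rfl fun j _ => by ring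

theorem LocIso.of_isometric {L M : EvenLattice} {R : Type*} [CommRing R]
    (h : IsometricOver R L M) : LocIso L M R := by
  obtain ⟨e, he⟩ := h
  refine ⟨LinearMap.toMatrix' e.toLinearMap, LinearMap.toMatrix' e.symm.toLinearMap, ?_, ?_, ?_⟩
  · ext i j
    have := he (Pi.single i 1) (Pi.single j 1)
    have key : ∀ z, e z = LinearMap.toMatrix' e.toLinearMap *ᵥ z := fun z => by
      rw [LinearMap.toMatrix'_mulVec]; rfl
    rw [formR_eq, formR_eq, key, key, mulVec_mulVec, ← vecMul_transpose, ← dotProduct_mulVec,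
      mulVec_mulVec, ← Matrix.mul_assoc] at this
    simpa using this
  · rw [← LinearMap.toMatrix'_comp]; simp
  · rw [← LinearMap.toMatrix'_comp]; simp

theorem LocIso.map {L M : EvenLattice} {R S : Type*} [CommRing R] [CommRing S] (f : R →+* S)
    (h : LocIso L M R) : LocIso L M S := by
  obtain ⟨U, V, h1, h2, h3⟩ := h
  have hc : ∀ (n : ℕ) (B : Matrix (Fin n) (Fin n) ℤ),
      (B.map (Int.cast : ℤ → R)).map f = B.map (Int.cast : ℤ → S) := by
    intro n B; ext i j; simp
  refine ⟨U.map f, V.map f, ?_, ?_, ?_⟩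
  · rw [← hc, ← hc, ← transpose_map, ← Matrix.map_mul, ← Matrix.map_mul, h1]
  · rw [← Matrix.map_mul, h2]; simp
  · rw [← Matrix.map_mul, h3]; simp

theorem LocIso.prod {L M : EvenLattice} {R S : Type*} [CommRing R] [CommRing S]
    (h : LocIso L M R) (h' : LocIso L M S) : LocIso L M (R × S) := by
  obtain ⟨U, V, h1, h2, h3⟩ := h
  obtain ⟨U', V', h1', h2', h3'⟩ := h'
  refine ⟨of fun i j => (U i j, U' i j), of fun i j => (V i j, V' i j), ?_, ?_, ?_⟩
  · ext i j
    · have := congrFun₂ h1 i j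
      simpa [mul_apply, Prod.fst_sum] using this
    · have := congrFun₂ h1' i j
      simpa [mul_apply, Prod.snd_sum] using this
  · ext i j
    · have := congrFun₂ h2 i j
      rw [mul_apply] at this
      simp only [mul_apply, Prod.fst_sum, of_apply, Prod.fst_mul, this]
      simp only [one_apply]; split <;> rfl
    · have := congrFun₂ h2' i j
      rw [mul_apply] at this
      simp only [mul_apply, Prod.snd_sum, of_apply, Prod.snd_mul, this]
      simp only [one_apply]; split <;> rfl
  · ext i j
    · have := congrFun₂ h3 i j
      rw [mul_apply] at this
      simp only [mul_apply, Prod.fst_sum, of_apply, Prod.fst_mul, this]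
      simp only [one_apply]; split <;> rfl
    · have := congrFun₂ h3' i j
      rw [mul_apply] at this
      simp only [mul_apply, Prod.snd_sum, of_apply, Prod.snd_mul, this]
      simp only [one_apply]; split <;> rfl

theorem LocIso.zmod {L M : EvenLattice} (h : SameGenus L M) (N : ℕ) (hN : 0 < N) :
    LocIso L M (ZMod N) := by
  induction N using Nat.recOnPosPrimePosCoprime with
  | zero => omega
  | one =>
    have := LocIso.of_isometric (h.1 2)
    exact this.map (PadicInt.toZModPow (p := 2) 0)
  | prime_pow p n hp hn =>
    have : Fact p.Prime := ⟨hp⟩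
    exact (LocIso.of_isometric (h.1 p)).map (PadicInt.toZModPow n)
  | coprime a b ha hb hab iha ihb =>
    exact ((iha (by omega)).prod (ihb (by omega))).map
      (ZMod.chineseRemainder hab).symm.toRingHom

/-- Integral congruence data. -/
theorem exists_int {L M : EvenLattice} (h : SameGenus L M) (N : ℕ) (hN : 0 < N) :
    ∃ (U : Matrix (Fin M.n) (Fin L.n) ℤ) (V : Matrix (Fin L.n) (Fin M.n) ℤ)
      (E : Matrix (Fin L.n) (Fin L.n) ℤ) (F : Matrix (Fin M.n) (Fin M.n) ℤ)
      (G : Matrix (Fin L.n) (Fin L.n) ℤ),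
      Uᵀ * M.B * U = L.B + (N : ℤ) • E ∧ U * V = 1 + (N : ℤ) • F ∧ V * U = 1 + (N : ℤ) • G := by
  obtain ⟨U, V, h1, h2, h3⟩ := LocIso.zmod h N hN
  have lift : ∀ {a b : ℕ} (A : Matrix (Fin a) (Fin b) (ZMod N)),
      ∃ A' : Matrix (Fin a) (Fin b) ℤ, A'.map (Int.castRingHom (ZMod N)) = A := by
    intro a b A
    choose g hg using fun i j => ZMod.intCast_surjective (A i j)
    exact ⟨of g, by ext i j; simp [hg]⟩
  have key : ∀ {a b : ℕ} (A B : Matrix (Fin a) (Fin b) ℤ),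
      A.map (Int.castRingHom (ZMod N)) = B.map (Int.castRingHom (ZMod N)) →
      ∃ E, A = B + (N : ℤ) • E := by
    intro a b A B hAB
    have : ∀ i j, ∃ k, A i j = B i j + N * k := by
      intro i j
      have := congrFun₂ hAB i j
      simp only [Matrix.map_apply, eq_intCast] at this
      obtain ⟨k, hk⟩ := (ZMod.intCast_eq_intCast_iff_dvd_sub _ _ _).1 this.symm
      exact ⟨k, by linarith⟩
    choose g hg using this
    exact ⟨of g, by ext i j; simp [hg]⟩
  obtain ⟨U, rfl⟩ := lift U
  obtain ⟨V, rfl⟩ := lift V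
  obtain ⟨E, hE⟩ := key (Uᵀ * M.B * U) L.B (by
    rw [Matrix.map_mul, Matrix.map_mul, transpose_map]; exact h1)
  obtain ⟨F, hF⟩ := key (U * V) 1 (by rw [Matrix.map_mul, h2]; simp)
  obtain ⟨G, hG⟩ := key (V * U) 1 (by rw [Matrix.map_mul, h3]; simp)
  exact ⟨U, V, E, F, G, hE, hF, hG⟩

/-- rational version of an integral matrix -/
def qm {a b : ℕ} (A : Matrix (Fin a) (Fin b) ℤ) : Matrix (Fin a) (Fin b) ℚ :=
  A.map (Int.castRingHom ℚ)

theorem qm_mul {a b c : ℕ} (A : Matrix (Fin a) (Fin b) ℤ) (B : Matrix (Fin b) (Fin c) ℤ) :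
    qm (A * B) = qm A * qm B := Matrix.map_mul
theorem qm_add {a b : ℕ} (A B : Matrix (Fin a) (Fin b) ℤ) :
    qm (A + B) = qm A + qm B := by ext; simp [qm]
theorem qm_one {a : ℕ} : qm (1 : Matrix (Fin a) (Fin a) ℤ) = 1 := by simp [qm]
theorem qm_smul {a b : ℕ} (k : ℤ) (A : Matrix (Fin a) (Fin b) ℤ) :
    qm (k • A) = (k : ℚ) • qm A := by ext; simp [qm]
theorem qm_tr {a b : ℕ} (A : Matrix (Fin a) (Fin b) ℤ) : qm Aᵀ = (qm A)ᵀ := by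
  ext; simp [qm]

/-- integral vectors -/
def IsI {n : ℕ} (x : Fin n → ℚ) : Prop := ∀ i, ∃ m : ℤ, x i = m

theorem IsI.lift {n : ℕ} {x : Fin n → ℚ} (h : IsI x) :
    ∃ z : Fin n → ℤ, x = fun i => (z i : ℚ) := by
  choose z hz using h
  exact ⟨z, funext hz⟩

theorem IsI.add {n : ℕ} {x y : Fin n → ℚ} (h : IsI x) (h' : IsI y) : IsI (x + y) := fun i => by
  obtain ⟨a, ha⟩ := h i
  obtain ⟨b, hb⟩ := h' i
  exact ⟨a + b, by simp [ha, hb]⟩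
theorem IsI.sub {n : ℕ} {x y : Fin n → ℚ} (h : IsI x) (h' : IsI y) : IsI (x - y) := fun i => by
  obtain ⟨a, ha⟩ := h i
  obtain ⟨b, hb⟩ := h' i
  exact ⟨a - b, by simp [ha, hb]⟩
theorem IsI.smul {n : ℕ} {x : Fin n → ℚ} (h : IsI x) (k : ℤ) : IsI ((k : ℚ) • x) := fun i => by
  obtain ⟨a, ha⟩ := h i
  exact ⟨k * a, by simp [ha]⟩
theorem IsI.dot {n : ℕ} {x y : Fin n → ℚ} (h : IsI x) (h' : IsI y) : ∃ m : ℤ, x ⬝ᵥ y = m := by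
  obtain ⟨a, rfl⟩ := h.lift
  obtain ⟨b, rfl⟩ := h'.lift
  exact ⟨∑ i, a i * b i, by simp [dotProduct]⟩
theorem IsI.mul {a b : ℕ} {x : Fin b → ℚ} (h : IsI x) (A : Matrix (Fin a) (Fin b) ℤ) :
    IsI (qm A *ᵥ x) := fun i =>
  IsI.dot (fun j => ⟨A i j, by simp [qm]⟩) h

theorem formR_qm (L : EvenLattice) (x y : Fin L.n → ℚ) : formR L ℚ x y = x ⬝ᵥ (qm L.B *ᵥ y) :=
  formR_eq L ℚ x y

theorem qm_symm (L : EvenLattice) : (qm L.B)ᵀ = qm L.B := by rw [← qm_tr, L.symm]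

theorem formR_comm (L : EvenLattice) (x y : Fin L.n → ℚ) : formR L ℚ x y = formR L ℚ y x := by
  rw [formR_qm, formR_qm, dotProduct_mulVec, dotProduct_comm, ← mulVec_transpose, qm_symm]

theorem mem_int {L : EvenLattice} {x : Fin L.n → ℚ} : x ∈ intSub L ↔ IsI x := Iff.rfl

theorem mem_dual {L : EvenLattice} {x : Fin L.n → ℚ} : x ∈ dualSub L ↔ IsI (qm L.B *ᵥ x) := by
  constructor
  · intro h i
    obtain ⟨m, hm⟩ := h (Pi.single i 1) (fun j => by
      by_cases hj : j = i
      · subst hj; exact ⟨1, by simp⟩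
      · exact ⟨0, by simp [hj]⟩)
    rw [formR_comm, formR_qm] at hm
    exact ⟨m, by simpa using hm⟩
  · intro h y hy
    rw [formR_comm, formR_qm]
    exact IsI.dot hy h

theorem dual_denom {L : EvenLattice} {x : Fin L.n → ℚ} (h : IsI (qm L.B *ᵥ x)) :
    IsI ((L.B.det : ℚ) • x) := by
  have := h.mul L.B.adjugate
  rwa [mulVec_mulVec, ← qm_mul, adjugate_mul, qm_smul, qm_one, smul_mulVec, one_mulVec] at this

theorem even_int (L : EvenLattice) (z : Fin L.n → ℤ) : (2 : ℤ) ∣ z ⬝ᵥ (L.B *ᵥ z) := by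
  refine (ZMod.intCast_zmod_eq_zero_iff_dvd _ 2).1 ?_
  have : z ⬝ᵥ (L.B *ᵥ z) = ∑ p : Fin L.n × Fin L.n, z p.1 * (L.B p.1 p.2 * z p.2) := by
    rw [Fintype.sum_prod_type]
    simp [dotProduct, mulVec, Finset.mul_sum]
  rw [this, Int.cast_sum]
  refine Finset.sum_involution (fun p _ => p.swap) ?_ ?_ ?_ ?_
  · rintro ⟨i, j⟩ _
    have hs : L.B j i = L.B i j := L.symm.apply i j
    simp only [Prod.swap, hs]
    push_cast
    have : (2 : ZMod 2) = 0 := rfl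
    linear_combination (z i * (L.B i j * z j) : ZMod 2) * this
  · rintro ⟨i, j⟩ _ hne heq
    simp only [Prod.swap, Prod.mk.injEq] at heq
    obtain ⟨rfl, _⟩ := heq
    apply hne
    have : ((L.B j j : ℤ) : ZMod 2) = 0 := (ZMod.intCast_zmod_eq_zero_iff_dvd _ 2).2 (L.even_diag j)
    simp [this]
  · simp
  · simp

theorem formR_add_self (L : EvenLattice) {x l : Fin L.n → ℚ} (hx : x ∈ dualSub L)
    (hl : l ∈ intSub L) : ∃ k : ℤ, formR L ℚ (x + l) (x + l) = formR L ℚ x x + k * 2 := by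
  obtain ⟨m, hm⟩ := hx l hl
  obtain ⟨z, rfl⟩ := IsI.lift hl
  obtain ⟨c, hc⟩ := even_int L z
  refine ⟨m + c, ?_⟩
  set l : Fin L.n → ℚ := fun i => (z i : ℚ) with hl'
  have h2 : formR L ℚ l l = 2 * c := by
    have : formR L ℚ l l = ((z ⬝ᵥ (L.B *ᵥ z) : ℤ) : ℚ) := by
      rw [formR_qm]; simp [hl', dotProduct, mulVec, qm]
    rw [this, hc]; push_cast; rfl
  rw [formR_add_left, formR_comm L x (x + l), formR_comm L l (x + l), formR_add_left,
    formR_add_left, formR_comm L l x, hm, h2]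
  push_cast; ring

theorem discQ_mk (L : EvenLattice) (x : dualSub L) :
    discQ L (QuotientAddGroup.mk x) = (QuotientAddGroup.mk (formR L ℚ x x) : Qmod2Z) := by
  obtain ⟨⟨l, hl⟩, h⟩ := QuotientAddGroup.mk_out_eq_add ((intSub L).addSubgroupOf (dualSub L)) x
  unfold discQ discQOf
  rw [h]
  obtain ⟨k, hk⟩ := formR_add_self L x.2 (l := l) hl
  symm
  rw [QuotientAddGroup.eq]
  refine AddSubgroup.mem_zmultiples_iff.2 ⟨k, ?_⟩
  have : formR L ℚ ((x + l : dualSub L) : Fin L.n → ℚ) ((x + l : dualSub L) : Fin L.n → ℚ) =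
    formR L ℚ x x + k * 2 := hk
  show _ = -_ + formR L ℚ ((x + l : dualSub L) : Fin L.n → ℚ) ((x + l : dualSub L) : Fin L.n → ℚ)
  rw [this]; simp

theorem disc_iso {L M : EvenLattice} (h : SameGenus L M) : FQSIsometric (discQ L) (discQ M) := by
  set d : ℤ := L.B.det * M.B.det with hd
  have hd0 : d ≠ 0 := mul_ne_zero L.nondeg M.nondeg
  obtain ⟨U, V, E, F, G, hE, hF, hG⟩ := exists_int h (2 * d.natAbs * d.natAbs) (by positivity)
  have hN : ((2 * d.natAbs * d.natAbs : ℕ) : ℤ) = 2 * d * d := by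
    push_cast
    rw [mul_assoc, mul_assoc, ← abs_mul, abs_mul_self]
  rw [hN] at hE hF hG
  replace hE := congrArg qm hE
  replace hF := congrArg qm hF
  replace hG := congrArg qm hG
  simp only [qm_mul, qm_add, qm_smul, qm_one, qm_tr] at hE hF hG
  have dL : ∀ {x}, x ∈ dualSub L → IsI ((d : ℚ) • x) := by
    intro x hx
    have := (dual_denom (mem_dual.1 hx)).smul M.B.det
    rw [smul_smul] at this
    convert this using 2
    rw [hd]; push_cast; ring
  have dM : ∀ {x}, x ∈ dualSub M → IsI ((d : ℚ) • x) := by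
    intro x hx
    have := (dual_denom (mem_dual.1 hx)).smul L.B.det
    rw [smul_smul] at this
    convert this using 2
    rw [hd]; push_cast; ring
  have toN : ∀ {n : ℕ} {x : Fin n → ℚ}, IsI ((d : ℚ) • x) →
      IsI (((2 * d * d : ℤ) : ℚ) • x) := by
    intro n x hx
    have := hx.smul (2 * d)
    rw [smul_smul] at this
    convert this using 2
    push_cast; ring
  set N : ℤ := 2 * d * d with hNd
  -- U maps dual to dual
  have hU : ∀ x, x ∈ dualSub L → qm U *ᵥ x ∈ dualSub M := by
    intro x hx
    have hNx := toN (dL hx)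
    rw [mem_dual]
    have h1 : IsI ((qm U)ᵀ *ᵥ (qm M.B *ᵥ (qm U *ᵥ x))) := by
      rw [mulVec_mulVec, mulVec_mulVec, hE, add_mulVec, smul_mulVec,
        ← mulVec_smul]
      exact (mem_dual.1 hx).add (hNx.mul E)
    have h2 := h1.mul Vᵀ
    rw [mulVec_mulVec, qm_tr, ← transpose_mul, hF, transpose_add, transpose_one, transpose_smul,
      add_mulVec, one_mulVec, smul_mulVec, ← mulVec_smul, ← mulVec_smul, ← mulVec_smul,
      ← qm_tr] at h2
    have h3 := (((hNx.mul U).mul M.B).mul Fᵀ)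
    simpa using h2.sub h3
  have hV : ∀ y, y ∈ dualSub M → qm V *ᵥ y ∈ dualSub L := by
    intro y hy
    have hNy := toN (dM hy)
    rw [mem_dual]
    have e1 : qm L.B = (qm U)ᵀ * qm M.B * qm U - (N : ℚ) • qm E := by rw [hE]; simp
    rw [e1, sub_mulVec, mulVec_mulVec, Matrix.mul_assoc, hF, smul_mulVec, ← mulVec_smul,
      ← mulVec_smul, ← mulVec_mulVec, ← mulVec_mulVec, add_mulVec, one_mulVec, smul_mulVec,
      ← mulVec_smul, mulVec_add, ← qm_tr]
    exact (((mem_dual.1 hy).add ((hNy.mul F).mul M.B)).mul Uᵀ).sub ((hNy.mul V).mul E)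
  let f0 : dualSub L →+ dualSub M :=
    AddMonoidHom.mk' (fun x => ⟨qm U *ᵥ x.1, hU _ x.2⟩) (fun a b => by
      ext1; simp [mulVec_add])
  have hf : (intSub L).addSubgroupOf (dualSub L) ≤
      ((intSub M).addSubgroupOf (dualSub M)).comap f0 := by
    intro x hx
    exact IsI.mul (x := x.1) hx U
  let f : discGroup L →+ discGroup M := QuotientAddGroup.map _ _ f0 hf
  have hinj : Function.Injective f := by
    rw [injective_iff_map_eq_zero]
    intro a
    induction a using QuotientAddGroup.induction_on with
    | H x =>
    intro hx
    have hx' : IsI (qm U *ᵥ x.1) := (QuotientAddGroup.eq_zero_iff (f0 x)).1 hx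
    refine (QuotientAddGroup.eq_zero_iff x).2 ?_
    show IsI x.1
    have h2 := hx'.mul V
    rw [mulVec_mulVec, hG, add_mulVec, one_mulVec, smul_mulVec, ← mulVec_smul] at h2
    simpa using h2.sub ((toN (dL x.2)).mul G)
  have hsurj : Function.Surjective f := by
    intro b
    induction b using QuotientAddGroup.induction_on with
    | H y =>
    refine ⟨QuotientAddGroup.mk ⟨qm V *ᵥ y.1, hV _ y.2⟩, ?_⟩
    show QuotientAddGroup.mk (f0 _) = _
    symm
    rw [QuotientAddGroup.eq]
    show IsI (-y.1 + qm U *ᵥ (qm V *ᵥ y.1))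
    rw [mulVec_mulVec, hF, add_mulVec, one_mulVec, smul_mulVec, ← mulVec_smul]
    simpa using (toN (dM y.2)).mul F
  refine ⟨AddEquiv.ofBijective f ⟨hinj, hsurj⟩, ?_⟩
  intro a
  induction a using QuotientAddGroup.induction_on with
  | H x =>
  show discQ M (QuotientAddGroup.mk (f0 x)) = _
  rw [discQ_mk, discQ_mk]
  symm
  rw [QuotientAddGroup.eq]
  obtain ⟨k, hk⟩ := (dL x.2).dot ((dL x.2).mul E)
  refine AddSubgroup.mem_zmultiples_iff.2 ⟨k, ?_⟩
  show _ = -formR L ℚ x.1 x.1 + formR M ℚ (qm U *ᵥ x.1) (qm U *ᵥ x.1)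
  have : formR M ℚ (qm U *ᵥ x.1) (qm U *ᵥ x.1) = formR L ℚ x.1 x.1 + k * 2 := by
    rw [formR_qm, formR_qm, mulVec_mulVec, ← vecMul_transpose, ← dotProduct_mulVec, mulVec_mulVec,
      ← Matrix.mul_assoc, hE, add_mulVec, dotProduct_add, smul_mulVec, dotProduct_smul, ← hk,
      mulVec_smul, smul_dotProduct, dotProduct_smul, hNd]
    simp only [smul_eq_mul]; push_cast; ring
  rw [this]; simp

theorem sig_set {L M : EvenLattice} (h : IsometricOver ℝ L M) (P : ℝ → Prop) (d : ℕ)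
    (hd : ∃ W : Submodule ℝ (Fin L.n → ℝ), Module.finrank ℝ W = d ∧
      ∀ x ∈ W, x ≠ 0 → P (formR L ℝ x x)) :
    ∃ W : Submodule ℝ (Fin M.n → ℝ), Module.finrank ℝ W = d ∧
      ∀ x ∈ W, x ≠ 0 → P (formR M ℝ x x) := by
  obtain ⟨e, he⟩ := h
  obtain ⟨W, hW, hP⟩ := hd
  refine ⟨W.map e.toLinearMap, ?_, ?_⟩
  · rw [← hW]; exact LinearEquiv.finrank_map_eq e W
  · rintro _ ⟨x, hx, rfl⟩ hne
    show P (formR M ℝ (e x) (e x))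
    rw [he]
    refine hP x hx ?_
    rintro rfl
    exact hne (by simp)

theorem IsometricOver.symm' {R : Type*} [CommRing R] {L M : EvenLattice}
    (h : IsometricOver R L M) : IsometricOver R M L := by
  obtain ⟨e, he⟩ := h
  exact ⟨e.symm, fun x y => by rw [← he]; simp⟩

/-- **The genus determines the discriminant form and the signature.**
If two even lattices lie in the same genus, then their discriminant forms are isometric
and their signatures agree. -/
theorem discriminant_form_and_signature_determined_by_genus
    (L M : EvenLattice) (h : SameGenus L M) :
    FQSIsometric (discQ L) (discQ M) ∧ sigPlus L = sigPlus M ∧ sigMinus L = sigMinus M := by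
  refine ⟨disc_iso h, ?_, ?_⟩
  · unfold sigPlus
    congr 1
    ext d
    exact ⟨sig_set h.2 (fun r => 0 < r) d, sig_set h.2.symm' (fun r => 0 < r) d⟩
  · unfold sigMinus
    congr 1
    ext d
    exact ⟨sig_set h.2 (fun r => r < 0) d, sig_set h.2.symm' (fun r => r < 0) d⟩
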